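/- Let (X,d) be a finite metric space with |X| ≥ 2 and let c := d. Then r*_c(P(X)) < 55.7·(1 + log|X|), where log denotes the natural logarithm. -/

import Mathlib

open MeasureTheory ENNReal

noncomputable section

/-- The optimal transport cost `C*_c(P,Q)` between two Borel measures for the cost `c`:
the infimum of `∫ c dγ` over couplings `γ` of `(P, Q)`. -/
def Cstar {X : Type*} [MeasurableSpace X] (c : X → X → ℝ) (P Q : Measure X) : ℝ≥0∞ :=
  ⨅ γ ∈ {γ : Measure (X × X) |
      IsProbabilityMeasure γ ∧ γ.map Prod.fst = P ∧ γ.map Prod.snd = Q},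
    ∫⁻ z, ENNReal.ofReal (c z.1 z.2) ∂γ

/-- The standard probability space: `[0,1]` with Lebesgue measure. -/
def stdSpace : Measure ℝ := volume.restrict (Set.Icc (0 : ℝ) 1)

/-- `f` is a coupling of the family of probability measures `P` on the standard
probability space `([0,1], Lebesgue)`: each `f a` is measurable with law `P a`. -/
structure IsCoupling {X A : Type*} [MeasurableSpace X]
    (P : A → Measure X) (f : A → ℝ → X) : Prop where
  measurable : ∀ a, Measurable (f a)
  law : ∀ a, stdSpace.map (f a) = P a

/-- The pairwise coupling ratio `r_c({X_α})` of a coupling `f` of the family `P`: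
the least `r ≥ 1` such that `E[c(X_a, X_b)] ≤ r ⬝ C*_c(P_a, P_b)` for all `a, b`
(`∞` if no such `r` exists). -/
def couplingRatio {X A : Type*} [MeasurableSpace X]
    (c : X → X → ℝ) (P : A → Measure X) (f : A → ℝ → X) : ℝ≥0∞ :=
  sInf {r : ℝ≥0∞ | 1 ≤ r ∧ ∀ a b : A,
    ∫⁻ u, ENNReal.ofReal (c (f a u) (f b u)) ∂stdSpace ≤ r * Cstar c (P a) (P b)}

/-- The optimal pairwise coupling ratio `r*_c({P_α})` of a family of probability
measures: the infimum of `r_c({X_α})` over all couplings of the family. -/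
def optRatio {X A : Type*} [MeasurableSpace X]
    (c : X → X → ℝ) (P : A → Measure X) : ℝ≥0∞ :=
  ⨅ (f : A → ℝ → X) (_ : IsCoupling P f), couplingRatio c P f

instance isProbabilityMeasure_stdSpace : IsProbabilityMeasure stdSpace :=
  ⟨by simp [stdSpace]⟩

lemma stdSpace_real_Ico {a b : ℝ} (ha : 0 ≤ a) (hab : a ≤ b) (hb : b ≤ 1) :
    stdSpace.real (Set.Ico a b) = b - a := by
  rw [stdSpace, measureReal_restrict_apply measurableSet_Ico,
    Set.inter_eq_left.2 (Set.Ico_subset_Icc_self.trans (Set.Icc_subset_Icc ha hb)),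
    Real.volume_real_Ico_of_le hab]

lemma stdSpace_real_uIcc_le (a b : ℝ) : stdSpace.real (Set.uIcc a b) ≤ |a - b| := by
  rw [stdSpace, measureReal_restrict_apply measurableSet_uIcc]
  calc _ ≤ volume.real (Set.uIcc a b) := measureReal_mono Set.inter_subset_left (by simp)
    _ = |a - b| := by rw [Real.volume_real_interval, abs_sub_comm]

lemma stdSpace_ae_mem_Ico : ∀ᵐ u ∂stdSpace, u ∈ Set.Ico (0 : ℝ) 1 := by
  rw [stdSpace, ← restrict_Ico_eq_restrict_Icc]
  exact ae_restrict_mem measurableSet_Ico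

/-- Every probability measure on a standard Borel space is a law on the standard space. -/
lemma exists_measurable_map_stdSpace_eq {Ω : Type*} [MeasurableSpace Ω] [StandardBorelSpace Ω]
    (μ : Measure Ω) [IsProbabilityMeasure μ] :
    ∃ φ : ℝ → Ω, Measurable φ ∧ stdSpace.map φ = μ := by
  have : Nonempty Ω := nonempty_of_isProbabilityMeasure μ
  obtain ⟨f, hf, hfμ⟩ := μ.exists_measurable_map_eq
  refine ⟨fun x => f (Set.projIcc 0 1 zero_le_one x), by fun_prop, ?_⟩
  have h : stdSpace.map (Set.projIcc (0 : ℝ) 1 zero_le_one) = volume := by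
    rw [stdSpace, volume_set_coe_def, ← map_comap_subtype_coe measurableSet_Icc,
      Measure.map_map (by fun_prop) (by fun_prop)]
    convert Measure.map_id
    ext x
    simp
  rw [← hfμ, ← h, Measure.map_map hf (by fun_prop)]
  rfl

/-- A simultaneous sampler for all probability vectors on a finite type, whose mismatch
probability is at most `K` times the `ℓ¹` distance of the vectors. -/
structure IsSampler {X Ω : Type*} [Fintype X] [MeasurableSpace X] [MeasurableSpace Ω]
    (μ : Measure Ω) (Y : (X → ℝ) → Ω → X) (K : ℝ) : Prop where
  measurable : ∀ p, Measurable (Y p)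
  law : ∀ p ∈ stdSimplex ℝ X, ∀ x, μ.real {u | Y p u = x} = p x
  mismatch : ∀ p ∈ stdSimplex ℝ X, ∀ q ∈ stdSimplex ℝ X,
    μ.real {u | Y p u ≠ Y q u} ≤ K * ∑ x, |p x - q x|

/-- A sampler can be transported to the standard space. -/
lemma IsSampler.exists_stdSpace {X Ω : Type*} [Fintype X] [MeasurableSpace X]
    [DiscreteMeasurableSpace X]
    [MeasurableSpace Ω] [StandardBorelSpace Ω] {μ : Measure Ω} [IsProbabilityMeasure μ]
    {Y : (X → ℝ) → Ω → X} {K : ℝ} (h : IsSampler μ Y K) :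
    ∃ Y' : (X → ℝ) → ℝ → X, IsSampler stdSpace Y' K := by
  obtain ⟨φ, hφ, rfl⟩ := exists_measurable_map_stdSpace_eq μ
  refine ⟨fun p u => Y p (φ u), fun p => (h.measurable p).comp hφ, fun p hp x => ?_,
    fun p hp q hq => ?_⟩
  · rw [← h.law p hp x, map_measureReal_apply hφ]
    · rfl
    · exact h.measurable p (MeasurableSet.of_discrete (s := {x}))
  · refine le_of_eq_of_le ?_ (h.mismatch p hp q hq)
    rw [map_measureReal_apply hφ]
    · rfl
    · exact (measurableSet_eq_fun (h.measurable p) (h.measurable q)).compl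

/-- The cumulative sums of a vector along an enumeration. -/
def cumSum {X : Type*} [Fintype X] {n : ℕ} (e : X ≃ Fin n) (p : X → ℝ) (k : ℕ) : ℝ :=
  ∑ x with (e x : ℕ) < k, p x

section cumSum
variable {X : Type*} [Fintype X] {n : ℕ} (e : X ≃ Fin n) (p q : X → ℝ)

lemma cumSum_zero : cumSum e p 0 = 0 := by simp [cumSum]

lemma cumSum_succ (x : X) : cumSum e p (e x + 1) = cumSum e p (e x) + p x := by
  classical
  have : (Finset.univ.filter fun y => (e y : ℕ) < e x + 1)
      = insert x (Finset.univ.filter fun y => (e y : ℕ) < e x) := by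
    ext y
    simp only [Finset.mem_filter, Finset.mem_univ, true_and, Finset.mem_insert,
      Nat.lt_succ_iff_lt_or_eq]
    rw [or_comm, ← Fin.ext_iff, e.injective.eq_iff]
  rw [cumSum, this, Finset.sum_insert (by simp), add_comm, cumSum]

lemma cumSum_mono (hp : ∀ x, 0 ≤ p x) : Monotone (cumSum e p) := fun _ _ h =>
  Finset.sum_le_sum_of_subset_of_nonneg
    (Finset.monotone_filter_right _ fun _ _ hx => lt_of_lt_of_le hx h) fun x _ _ => hp x

lemma cumSum_card : cumSum e p n = ∑ x, p x := by simp [cumSum]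

lemma abs_cumSum_sub_le (k : ℕ) : |cumSum e p k - cumSum e q k| ≤ ∑ x, |p x - q x| := by
  rw [cumSum, cumSum, ← Finset.sum_sub_distrib]
  exact (Finset.abs_sum_le_sum_abs _ _).trans
    (Finset.sum_le_sum_of_subset_of_nonneg (Finset.subset_univ _) fun _ _ _ => abs_nonneg _)

end cumSum

/-- The quantile coupling is a sampler, with a constant depending on the size of the type. -/
lemma exists_isSampler_quantile (X : Type*) [Fintype X] [Nonempty X] [MeasurableSpace X]
    [DiscreteMeasurableSpace X] :
    ∃ (Y : (X → ℝ) → ℝ → X) (K : ℝ), IsSampler stdSpace Y K := by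
  classical
  let n := Fintype.card X
  have hn : 0 < n := Fintype.card_pos
  let e : X ≃ Fin n := Fintype.equivFin X
  let N (p : X → ℝ) (u : ℝ) : ℕ := Nat.findGreatest (fun k => cumSum e p k ≤ u) (n - 1)
  have hN (p u) : N p u < n := lt_of_le_of_lt (Nat.findGreatest_le _) (Nat.sub_lt hn one_pos)
  let Y (p : X → ℝ) (u : ℝ) : X := e.symm ⟨N p u, hN p u⟩
  have key : ∀ p ∈ stdSimplex ℝ X, ∀ u ∈ Set.Ico (0 : ℝ) 1, ∀ x,
      Y p u = x ↔ u ∈ Set.Ico (cumSum e p (e x)) (cumSum e p (e x) + p x) := by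
    intro p hp u hu
    have hmem : u ∈ Set.Ico (cumSum e p (e (Y p u))) (cumSum e p (e (Y p u)) + p (Y p u)) := by
      rw [← cumSum_succ]
      have hY : (e (Y p u) : ℕ) = N p u := by simp [Y]
      rw [hY]
      refine ⟨Nat.findGreatest_spec (P := fun k => cumSum e p k ≤ u) (Nat.zero_le _)
        (by simpa [cumSum_zero] using hu.1), ?_⟩
      by_cases h : N p u + 1 ≤ n - 1
      · exact not_le.1 (Nat.findGreatest_is_greatest (Nat.lt_succ_self _) h)
      · have : N p u + 1 = n := by have := hN p u; omega
        rw [this, cumSum_card, hp.2]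
        exact hu.2
    intro x
    refine ⟨fun h => h ▸ hmem, fun h => ?_⟩
    rw [← cumSum_succ] at h hmem
    have hm := cumSum_mono e p hp.1
    apply e.injective
    apply Fin.ext
    by_contra hne
    rcases lt_or_gt_of_ne hne with h1 | h1
    · exact absurd (hmem.2.trans_le ((hm h1).trans h.1)) (lt_irrefl _)
    · exact absurd (h.2.trans_le ((hm h1).trans hmem.1)) (lt_irrefl _)
  refine ⟨Y, 2 * n, fun p => ?_, fun p hp x => ?_, fun p hp q hq => ?_⟩
  · have : Measurable (N p) := measurable_findGreatest fun k _ =>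
      measurableSet_le measurable_const measurable_id
    have h2 : Measurable fun u => (⟨N p u, hN p u⟩ : {k // k < n}) := this.subtype_mk
    exact (Measurable.of_discrete (f := fun k : {k // k < n} => e.symm ⟨k.1, k.2⟩)).comp h2
  · have h0 : 0 ≤ cumSum e p (e x) := by
      rw [← cumSum_zero e p]; exact cumSum_mono e p hp.1 (Nat.zero_le _)
    have h1 : cumSum e p (e x) + p x ≤ 1 := by
      rw [← cumSum_succ, ← hp.2, ← cumSum_card e p]; exact cumSum_mono e p hp.1 (e x).2
    have := stdSpace_real_Ico h0 (by linarith [hp.1 x]) h1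
    rw [add_sub_cancel_left] at this
    rw [← this]
    apply measureReal_congr
    filter_upwards [stdSpace_ae_mem_Ico] with u hu
    exact propext (key p hp u hu x)
  · have hsub : stdSpace.real {u | Y p u ≠ Y q u} ≤ stdSpace.real (⋃ x : X,
        (Set.uIcc (cumSum e p (e x)) (cumSum e q (e x)) ∪
          Set.uIcc (cumSum e p (e x + 1)) (cumSum e q (e x + 1)))) := by
      refine ENNReal.toReal_mono (measure_ne_top _ _) (measure_mono_ae ?_)
      filter_upwards [stdSpace_ae_mem_Ico] with u hu hne
      have h1 := (key p hp u hu (Y p u)).1 rfl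
      have h2 := mt (key q hq u hu (Y p u)).2 (Ne.symm hne)
      refine Set.mem_iUnion.2 ⟨Y p u, ?_⟩
      rw [← cumSum_succ] at h1 h2
      simp only [Set.mem_Ico, not_and, not_lt] at h1 h2
      rcases le_or_gt (cumSum e q (e (Y p u))) u with h | h
      · exact Or.inr (Set.mem_uIcc.2 (Or.inr ⟨h2 h, h1.2.le⟩))
      · exact Or.inl (Set.mem_uIcc.2 (Or.inl ⟨h1.1, h.le⟩))
    refine hsub.trans ((measureReal_iUnion_fintype_le _).trans ?_)
    calc _ ≤ ∑ x : X, 2 * ∑ x, |p x - q x| := by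
          refine Finset.sum_le_sum fun x _ => (measureReal_union_le _ _).trans ?_
          have h1 := (stdSpace_real_uIcc_le _ _).trans (abs_cumSum_sub_le e p q (e x))
          have h2 := (stdSpace_real_uIcc_le _ _).trans (abs_cumSum_sub_le e p q (e x + 1))
          linarith
      _ = _ := by simp [n]; ring

lemma uniformOn_univ_singleton {A : Type*} [Fintype A] [Nonempty A] [MeasurableSpace A]
    [MeasurableSingletonClass A] (a : A) :
    ProbabilityTheory.uniformOn (Set.univ : Set A) {a} = ENNReal.ofReal (1 / Fintype.card A) := by
  rw [ProbabilityTheory.uniformOn_univ, Measure.count_singleton,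
    ENNReal.ofReal_div_of_pos (by exact_mod_cast Fintype.card_pos)]
  simp

lemma uniformOn_univ_prod_real {A Ω : Type*} [Fintype A] [Nonempty A] [MeasurableSpace A]
    [MeasurableSingletonClass A] [MeasurableSpace Ω] (ν : Measure Ω) [IsProbabilityMeasure ν]
    {S : Set (A × Ω)} (hS : MeasurableSet S) :
    ((ProbabilityTheory.uniformOn Set.univ).prod ν).real S
      = 1 / Fintype.card A * ∑ a, ν.real {ω | (a, ω) ∈ S} := by
  rw [measureReal_def, Measure.prod_apply hS, lintegral_fintype,
    ENNReal.toReal_sum (fun a _ => ENNReal.mul_ne_top (measure_ne_top _ _) (measure_ne_top _ _)),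
    Finset.mul_sum]
  refine Finset.sum_congr rfl fun a _ => ?_
  rw [uniformOn_univ_singleton, ENNReal.toReal_mul, ENNReal.toReal_ofReal (by positivity),
    mul_comm]
  rfl

lemma stdSpace_real_Iio {b : ℝ} (h0 : 0 ≤ b) (h1 : b ≤ 1) : stdSpace.real (Set.Iio b) = b := by
  refine Eq.trans (measureReal_congr ?_) ((stdSpace_real_Ico le_rfl h0 h1).trans (sub_zero b))
  filter_upwards [stdSpace_ae_mem_Ico] with u hu
  exact propext ⟨fun h => ⟨hu.1, h⟩, fun h => h.2⟩

lemma stdSpace_real_Ici {b : ℝ} (h0 : 0 ≤ b) (h1 : b ≤ 1) :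
    stdSpace.real (Set.Ici b) = 1 - b := by
  rw [← Set.compl_Iio, probReal_compl_eq_one_sub measurableSet_Iio, stdSpace_real_Iio h0 h1]

/-- One round of rejection sampling improves the constant of a sampler. -/
lemma IsSampler.exists_rejection {X : Type*} [Fintype X] [Nonempty X] [MeasurableSpace X]
    [DiscreteMeasurableSpace X] {Y : (X → ℝ) → ℝ → X} {K : ℝ} (h : IsSampler stdSpace Y K) :
    ∃ Y' : (X → ℝ) → ℝ → X, IsSampler stdSpace Y'
      (1 / Fintype.card X + (1 - 1 / Fintype.card X) * K) := by
  classical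
  set n : ℝ := (Fintype.card X : ℝ) with hn
  have hn0 : 0 < n := by rw [hn]; exact_mod_cast Fintype.card_pos
  let Y' (p : X → ℝ) (z : X × (ℝ × ℝ)) : X := if z.2.1 < p z.1 then z.1 else Y p z.2.2
  have hmeas (p) : Measurable (Y' p) := by
    refine Measurable.ite (measurableSet_lt (by fun_prop) ?_) measurable_fst
      ((h.measurable p).comp (by fun_prop))
    exact (Measurable.of_discrete (f := p)).comp measurable_fst
  have hle {p : X → ℝ} (hp : p ∈ stdSimplex ℝ X) (x : X) : p x ≤ 1 :=
    hp.2 ▸ Finset.single_le_sum (fun y _ => hp.1 y) (Finset.mem_univ x)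
  have hS : IsSampler ((ProbabilityTheory.uniformOn (Set.univ : Set X)).prod
      (stdSpace.prod stdSpace)) Y' (1 / n + (1 - 1 / n) * K) := by
    refine ⟨hmeas, fun p hp x => ?_, fun p hp q hq => ?_⟩
    · have hms : MeasurableSet {z | Y' p z = x} := hmeas p (MeasurableSet.of_discrete (s := {x}))
      rw [uniformOn_univ_prod_real _ hms]
      have hc (c : X) : (stdSpace.prod stdSpace).real {ω | Y' p (c, ω) = x}
          = (if c = x then p x else 0) + (1 - p c) * p x := by
        have h1 : {ω : ℝ × ℝ | Y' p (c, ω) = x}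
            = (Set.Iio (p c) ×ˢ {_u : ℝ | c = x}) ∪ (Set.Ici (p c) ×ˢ {u | Y p u = x}) := by
          ext ω
          simp only [Y', Set.mem_ofPred_eq, Set.mem_union, Set.mem_prod, Set.mem_Iio, Set.mem_Ici]
          split_ifs with hω
          · simp [hω, not_le.2 hω]
          · simp [hω, not_lt.1 hω]
        rw [h1, measureReal_union, measureReal_prod_prod, measureReal_prod_prod, h.law p hp,
          stdSpace_real_Iio (hp.1 c) (hle hp c), stdSpace_real_Ici (hp.1 c) (hle hp c)]
        · by_cases hcx : c = x <;> simp [hcx]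
        · rw [Set.disjoint_left]
          rintro ω ⟨hω, _⟩ ⟨hω', _⟩
          exact absurd (Set.mem_Iio.1 hω) (not_lt.2 hω')
        · exact measurableSet_Ici.prod (h.measurable p (MeasurableSet.of_discrete (s := {x})))
      calc _ = 1 / n * ∑ c, ((if c = x then p x else 0) + (1 - p c) * p x) :=
            congrArg (1 / n * ·) (Finset.sum_congr rfl fun c _ => hc c)
        _ = p x := by
          rw [Finset.sum_add_distrib, ← Finset.sum_mul, Finset.sum_sub_distrib, hp.2]
          simp only [Finset.sum_ite_eq', Finset.mem_univ, if_true, Finset.sum_const,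
            Finset.card_univ, nsmul_eq_mul, mul_one]
          rw [← hn]
          field_simp
          ring
    · have hms : MeasurableSet {z | Y' p z ≠ Y' q z} :=
        (measurableSet_eq_fun (hmeas p) (hmeas q)).compl
      rw [uniformOn_univ_prod_real _ hms]
      set E := stdSpace.real {u | Y p u ≠ Y q u} with hE
      have hc (c : X) : (stdSpace.prod stdSpace).real {ω | Y' p (c, ω) ≠ Y' q (c, ω)}
          ≤ |p c - q c| + (1 - p c) * E := by
        have h1 : {ω : ℝ × ℝ | Y' p (c, ω) ≠ Y' q (c, ω)}
            ⊆ (Set.uIcc (p c) (q c) ×ˢ Set.univ) ∪ (Set.Ici (p c) ×ˢ {u | Y p u ≠ Y q u}) := by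
          intro ω hω
          simp only [Y', Set.mem_ofPred_eq, Set.mem_union, Set.mem_prod, Set.mem_Ici,
            Set.mem_univ, and_true, Set.mem_uIcc] at hω ⊢
          split_ifs at hω with h1 h2 h2
          · exact absurd rfl hω
          · exact Or.inl (Or.inr ⟨not_lt.1 h2, h1.le⟩)
          · exact Or.inl (Or.inl ⟨not_lt.1 h1, h2.le⟩)
          · exact Or.inr ⟨not_lt.1 h1, hω⟩
        refine (measureReal_mono h1).trans ((measureReal_union_le _ _).trans ?_)
        rw [measureReal_prod_prod, measureReal_prod_prod,
          stdSpace_real_Ici (hp.1 c) (hle hp c), probReal_univ, mul_one]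
        have := stdSpace_real_uIcc_le (p c) (q c)
        linarith
      calc _ ≤ 1 / n * ∑ c, (|p c - q c| + (1 - p c) * E) :=
            mul_le_mul_of_nonneg_left (Finset.sum_le_sum fun c _ => hc c) (by positivity)
        _ = 1 / n * ∑ c, |p c - q c| + (1 - 1 / n) * E := by
          rw [Finset.sum_add_distrib, ← Finset.sum_mul, Finset.sum_sub_distrib, hp.2]
          simp only [Finset.sum_const, Finset.card_univ, nsmul_eq_mul, mul_one]
          rw [← hn]
          field_simp
        _ ≤ _ := by
          have h1 : 1 / n ≤ 1 := by
            rw [div_le_one hn0, hn]; exact_mod_cast Fintype.card_pos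
          have := mul_le_mul_of_nonneg_left (h.mismatch p hp q hq) (sub_nonneg.2 h1)
          linarith
  exact hS.exists_stdSpace

/-- Every finite type has a sampler with constant arbitrarily close to `1`. -/
lemma exists_isSampler (X : Type*) [Fintype X] [Nonempty X] [MeasurableSpace X]
    [DiscreteMeasurableSpace X] {C : ℝ} (hC : 1 < C) :
    ∃ Y : (X → ℝ) → ℝ → X, IsSampler stdSpace Y C := by
  set t : ℝ := 1 - 1 / Fintype.card X with ht
  have hn0 : (0 : ℝ) < Fintype.card X := by exact_mod_cast Fintype.card_pos
  have ht0 : 0 ≤ t := by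
    rw [ht, sub_nonneg, div_le_one hn0]; exact_mod_cast Fintype.card_pos
  have ht1 : t < 1 := by rw [ht]; linarith [one_div_pos.2 hn0]
  obtain ⟨Y₀, K, h₀⟩ := exists_isSampler_quantile X
  have hk (k : ℕ) : ∃ Y : (X → ℝ) → ℝ → X, IsSampler stdSpace Y (1 + t ^ k * (K - 1)) := by
    induction k with
    | zero => exact ⟨Y₀, by simpa using h₀⟩
    | succ k ih =>
      obtain ⟨Y, hY⟩ := ih
      obtain ⟨Y', hY'⟩ := hY.exists_rejection
      refine ⟨Y', ?_⟩
      convert hY' using 1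
      rw [← ht, pow_succ, show 1 / (Fintype.card X : ℝ) = 1 - t by rw [ht]; ring]
      ring
  have hlim : Filter.Tendsto (fun k : ℕ => 1 + t ^ k * (K - 1)) Filter.atTop (nhds 1) := by
    simpa using ((tendsto_pow_atTop_nhds_zero_of_lt_one ht0 ht1).mul_const (K - 1)).const_add 1
  obtain ⟨k, hkC⟩ := (hlim.eventually (gt_mem_nhds hC)).exists
  obtain ⟨Y, hY⟩ := hk k
  exact ⟨Y, hY.measurable, hY.law, fun p hp q hq => (hY.mismatch p hp q hq).trans
    (mul_le_mul_of_nonneg_right hkC.le (Finset.sum_nonneg fun _ _ => abs_nonneg _))⟩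

section refinement
variable {X : Type*} [Fintype X] [DecidableEq X]

/-- The image of a vector of masses under a map. -/
def pushMass (f : X → X) (p : X → ℝ) (a : X) : ℝ := ∑ x with f x = a, p x

/-- The `ℓ¹` distance between the images of two vectors of masses under a map. -/
def pushDist (f : X → X) (p q : X → ℝ) : ℝ := ∑ a, |pushMass f p a - pushMass f q a|

/-- The image of a vector of masses under `g`, conditionally on the value `a` of `f`. -/
def condMass (f g : X → X) (p : X → ℝ) (a b : X) : ℝ :=
  (if f b = a then pushMass g p b else 0) / pushMass f p a

lemma pushMass_nonneg (f : X → X) {p : X → ℝ} (hp : p ∈ stdSimplex ℝ X) (a : X) :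
    0 ≤ pushMass f p a := Finset.sum_nonneg fun x _ => hp.1 x

lemma sum_pushMass_fiber {f g : X → X} (hfg : ∀ x, f (g x) = f x) (p : X → ℝ) (a : X) :
    ∑ b, (if f b = a then pushMass g p b else 0) = pushMass f p a := by
  calc _ = ∑ b, ∑ x, if f b = a then (if g x = b then p x else 0) else 0 := by
        refine Finset.sum_congr rfl fun b _ => ?_
        split_ifs
        · rw [pushMass, Finset.sum_filter]
        · simp
    _ = pushMass f p a := by
        rw [Finset.sum_comm, pushMass, Finset.sum_filter]
        refine Finset.sum_congr rfl fun x _ => ?_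
        rw [Finset.sum_eq_single (g x) (fun b _ hb => by simp [Ne.symm hb]) (by simp), hfg]
        simp

lemma condMass_mem {f g : X → X} (hfg : ∀ x, f (g x) = f x) {p : X → ℝ}
    (hp : p ∈ stdSimplex ℝ X) {a : X} (ha : pushMass f p a ≠ 0) :
    condMass f g p a ∈ stdSimplex ℝ X := by
  refine ⟨fun b => div_nonneg ?_ (pushMass_nonneg f hp a), ?_⟩
  · split_ifs
    · exact pushMass_nonneg g hp b
    · exact le_rfl
  · simp only [condMass]
    rw [← Finset.sum_div, sum_pushMass_fiber hfg, div_self ha]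

lemma mul_sum_abs_condMass_sub_le {f g : X → X} (hfg : ∀ x, f (g x) = f x) {p q : X → ℝ}
    (hp : p ∈ stdSimplex ℝ X) (hq : q ∈ stdSimplex ℝ X) {a : X}
    (hpa : pushMass f p a ≠ 0) (hqa : pushMass f q a ≠ 0) :
    pushMass f p a * ∑ b, |condMass f g p a b - condMass f g q a b| ≤
      |pushMass f p a - pushMass f q a|
        + ∑ b, if f b = a then |pushMass g p b - pushMass g q b| else 0 := by
  have hc := condMass_mem hfg hq hqa
  calc _ ≤ ∑ b, (condMass f g q a b * |pushMass f p a - pushMass f q a|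
        + if f b = a then |pushMass g p b - pushMass g q b| else 0) := by
        rw [Finset.mul_sum]
        refine Finset.sum_le_sum fun b _ => ?_
        have h1 : pushMass f p a * |condMass f g p a b - condMass f g q a b|
            = |((if f b = a then pushMass g p b else 0) - if f b = a then pushMass g q b else 0)
              - condMass f g q a b * (pushMass f p a - pushMass f q a)| := by
          conv_lhs => rw [← abs_of_nonneg (pushMass_nonneg f hp a), ← abs_mul]
          congr 1
          simp only [condMass]
          field_simp
          ring
        rw [h1]
        refine (abs_sub _ _).trans ?_
        rw [abs_mul, abs_of_nonneg (hc.1 b), add_comm]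
        split_ifs <;> simp
    _ = _ := by rw [Finset.sum_add_distrib, ← Finset.sum_mul, hc.2, one_mul]

variable [MeasurableSpace X]

/-- Resample the label `g`, given the label `f`, with fresh randomness. -/
def refineSample (Y Z : (X → ℝ) → ℝ → X) (f g : X → X) (p : X → ℝ) (z : ℝ × ℝ) : X :=
  Y (condMass f g p (Z p z.1)) z.2

variable {Y Z : (X → ℝ) → ℝ → X} {K : ℝ} {f g : X → X}

lemma measurable_refineSample [DiscreteMeasurableSpace X] (hY : IsSampler stdSpace Y K)
    (hZ : ∀ p, Measurable (Z p))
    (p : X → ℝ) : Measurable (refineSample Y Z f g p) := by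
  have h1 : Measurable fun z : X × ℝ => Y (condMass f g p z.1) z.2 :=
    measurable_from_prod_countable_right fun a => by exact hY.measurable (condMass f g p a)
  exact h1.comp (((hZ p).comp measurable_fst).prodMk measurable_snd)

lemma refineSample_joint (hY : IsSampler stdSpace Y K)
    (hlaw : ∀ p ∈ stdSimplex ℝ X, ∀ a, stdSpace.real {u | Z p u = a} = pushMass f p a)
    (hfg : ∀ x, f (g x) = f x) {p : X → ℝ} (hp : p ∈ stdSimplex ℝ X) (a b : X) :
    (stdSpace.prod stdSpace).real {z | Z p z.1 = a ∧ refineSample Y Z f g p z = b}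
      = if f b = a then pushMass g p b else 0 := by
  have h1 : {z : ℝ × ℝ | Z p z.1 = a ∧ refineSample Y Z f g p z = b}
      = {u | Z p u = a} ×ˢ {v | Y (condMass f g p a) v = b} := by
    ext z
    simp only [refineSample, Set.mem_ofPred_eq, Set.mem_prod]
    exact and_congr_right fun h => by rw [h]
  rw [h1, measureReal_prod_prod, hlaw p hp]
  by_cases ha : pushMass f p a = 0
  · have h0 : ∀ b ∈ Finset.univ, 0 ≤ (if f b = a then pushMass g p b else 0) := fun b _ => by
      split_ifs
      · exact pushMass_nonneg g hp b
      · exact le_rfl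
    have := (Finset.sum_eq_zero_iff_of_nonneg h0).1 ((sum_pushMass_fiber hfg p a).trans ha) b
      (Finset.mem_univ b)
    rw [ha, zero_mul, this]
  · rw [hY.law _ (condMass_mem hfg hp ha), condMass, mul_div_cancel₀ _ ha]

lemma refineSample_law [DiscreteMeasurableSpace X] (hY : IsSampler stdSpace Y K)
    (hZ : ∀ p, Measurable (Z p))
    (hlaw : ∀ p ∈ stdSimplex ℝ X, ∀ a, stdSpace.real {u | Z p u = a} = pushMass f p a)
    (hfg : ∀ x, f (g x) = f x) {p : X → ℝ} (hp : p ∈ stdSimplex ℝ X) (b : X) :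
    (stdSpace.prod stdSpace).real {z | refineSample Y Z f g p z = b} = pushMass g p b := by
  have h1 : {z | refineSample Y Z f g p z = b}
      = ⋃ a, {z : ℝ × ℝ | Z p z.1 = a ∧ refineSample Y Z f g p z = b} := by
    ext z; simp
  rw [h1, measureReal_iUnion_fintype]
  · simp only [refineSample_joint hY hlaw hfg hp]
    simp
  · intro a a' haa'
    rw [Function.onFun, Set.disjoint_left]
    rintro z ⟨h, _⟩ ⟨h', _⟩
    exact haa' (h.symm.trans h')
  · intro a
    exact (((hZ p).comp measurable_fst) (MeasurableSet.of_discrete (s := {a}))).inter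
      (measurable_refineSample hY hZ p (MeasurableSet.of_discrete (s := {b})))

lemma refineSample_ae (hY : IsSampler stdSpace Y K)
    (hlaw : ∀ p ∈ stdSimplex ℝ X, ∀ a, stdSpace.real {u | Z p u = a} = pushMass f p a)
    (hfg : ∀ x, f (g x) = f x) {p : X → ℝ} (hp : p ∈ stdSimplex ℝ X) :
    ∀ᵐ z ∂(stdSpace.prod stdSpace), f (refineSample Y Z f g p z) = Z p z.1 := by
  rw [ae_iff]
  have h1 : {z : ℝ × ℝ | ¬ f (refineSample Y Z f g p z) = Z p z.1}
      ⊆ ⋃ (a : X), ⋃ (b : X), ⋃ (_ : f b ≠ a),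
        {z | Z p z.1 = a ∧ refineSample Y Z f g p z = b} := by
    intro z hz
    simp only [Set.mem_iUnion]
    exact ⟨_, _, hz, rfl, rfl⟩
  refine measure_mono_null h1 ?_
  simp only [measure_iUnion_null_iff]
  intro a b hab
  have := refineSample_joint hY hlaw hfg hp a b
  rwa [if_neg hab, measureReal_eq_zero_iff] at this

lemma refineSample_mismatch (hK : 0 ≤ K) (hY : IsSampler stdSpace Y K)
    (hlaw : ∀ p ∈ stdSimplex ℝ X, ∀ a, stdSpace.real {u | Z p u = a} = pushMass f p a)
    (hfg : ∀ x, f (g x) = f x) {p q : X → ℝ} (hp : p ∈ stdSimplex ℝ X)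
    (hq : q ∈ stdSimplex ℝ X) :
    (stdSpace.prod stdSpace).real
      {z | Z p z.1 = Z q z.1 ∧ refineSample Y Z f g p z ≠ refineSample Y Z f g q z}
      ≤ K * (pushDist f p q + pushDist g p q) := by
  have h1 : {z : ℝ × ℝ | Z p z.1 = Z q z.1 ∧
        refineSample Y Z f g p z ≠ refineSample Y Z f g q z}
      ⊆ ⋃ a, {u | Z p u = a ∧ Z q u = a} ×ˢ
        {v | Y (condMass f g p a) v ≠ Y (condMass f g q a) v} := by
    rintro z ⟨h, h'⟩
    refine Set.mem_iUnion.2 ⟨Z p z.1, ⟨rfl, h.symm⟩, ?_⟩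
    simp only [refineSample] at h'
    rwa [← h] at h'
  have h2 (a : X) : (stdSpace.prod stdSpace).real ({u | Z p u = a ∧ Z q u = a} ×ˢ
        {v | Y (condMass f g p a) v ≠ Y (condMass f g q a) v})
      ≤ K * (|pushMass f p a - pushMass f q a|
        + ∑ b, if f b = a then |pushMass g p b - pushMass g q b| else 0) := by
    rw [measureReal_prod_prod]
    have hrhs : 0 ≤ K * (|pushMass f p a - pushMass f q a|
        + ∑ b, if f b = a then |pushMass g p b - pushMass g q b| else 0) := by
      refine mul_nonneg hK (add_nonneg (abs_nonneg _) (Finset.sum_nonneg fun b _ => ?_))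
      split_ifs
      · exact abs_nonneg _
      · exact le_rfl
    have hmp : stdSpace.real {u | Z p u = a ∧ Z q u = a} ≤ pushMass f p a :=
      hlaw p hp a ▸ measureReal_mono fun u hu => hu.1
    have hmq : stdSpace.real {u | Z p u = a ∧ Z q u = a} ≤ pushMass f q a :=
      hlaw q hq a ▸ measureReal_mono fun u hu => hu.2
    by_cases hpa : pushMass f p a = 0
    · rw [le_antisymm (hpa ▸ hmp) measureReal_nonneg, zero_mul]
      exact hrhs
    by_cases hqa : pushMass f q a = 0
    · rw [le_antisymm (hqa ▸ hmq) measureReal_nonneg, zero_mul]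
      exact hrhs
    calc _ ≤ pushMass f p a * (K * ∑ b, |condMass f g p a b - condMass f g q a b|) :=
          mul_le_mul hmp (hY.mismatch _ (condMass_mem hfg hp hpa) _ (condMass_mem hfg hq hqa))
            measureReal_nonneg (pushMass_nonneg f hp a)
      _ = K * (pushMass f p a * ∑ b, |condMass f g p a b - condMass f g q a b|) := by ring
      _ ≤ _ := mul_le_mul_of_nonneg_left (mul_sum_abs_condMass_sub_le hfg hp hq hpa hqa) hK
  refine (measureReal_mono h1).trans ((measureReal_iUnion_fintype_le _).trans
    ((Finset.sum_le_sum fun a _ => h2 a).trans_eq ?_))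
  rw [← Finset.mul_sum, Finset.sum_add_distrib, Finset.sum_comm]
  simp [pushDist]

/-- Top-down sampling along a chain of retractions `F 0, F 1, …` of increasing fineness. -/
lemma exists_chain_sampler [DiscreteMeasurableSpace X] (hK : 0 ≤ K) (hY : IsSampler stdSpace Y K)
    (F : ℕ → X → X)
    (hF : ∀ i j x, j ≤ i → F j (F i x) = F j x) (c : X) (hF0 : ∀ x, F 0 x = c) (i : ℕ) :
    ∃ Z : (X → ℝ) → ℝ → X, (∀ p, Measurable (Z p)) ∧
      (∀ p ∈ stdSimplex ℝ X, ∀ a, stdSpace.real {u | Z p u = a} = pushMass (F i) p a) ∧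
      ∀ p ∈ stdSimplex ℝ X, ∀ q ∈ stdSimplex ℝ X, ∀ j < i,
        stdSpace.real {u | F j (Z p u) = F j (Z q u) ∧ F (j + 1) (Z p u) ≠ F (j + 1) (Z q u)}
          ≤ K * (pushDist (F j) p q + pushDist (F (j + 1)) p q) := by
  induction i with
  | zero =>
    refine ⟨fun _ _ => c, fun _ => measurable_const, fun p hp a => ?_, by simp⟩
    by_cases h : c = a
    · simp [pushMass, hF0, h, hp.2]
    · simp [pushMass, hF0, h]
  | succ i ih =>
    obtain ⟨Z, hZ, hlaw, hmis⟩ := ih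
    have hfg : ∀ x, F i (F (i + 1) x) = F i x := fun x => hF _ _ x (Nat.le_succ i)
    obtain ⟨φ, hφ, hφμ⟩ := exists_measurable_map_stdSpace_eq (stdSpace.prod stdSpace)
    let W := refineSample Y Z (F i) (F (i + 1))
    have hW : ∀ p, Measurable (W p) := measurable_refineSample hY hZ
    have hmap {S : Set (ℝ × ℝ)} (hS : MeasurableSet S) :
        stdSpace.real (φ ⁻¹' S) = (stdSpace.prod stdSpace).real S := by
      rw [← hφμ, map_measureReal_apply hφ hS]
    have hpair (p q) (A : Set (X × X)) : MeasurableSet {z | (W p z, W q z) ∈ A} :=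
      ((hW p).prodMk (hW q)) (MeasurableSet.of_discrete (s := A))
    refine ⟨fun p u => W p (φ u), fun p => (hW p).comp hφ, fun p hp a => ?_,
      fun p hp q hq j hj => ?_⟩
    · refine (hmap (hW p (MeasurableSet.of_discrete (s := {a})))).trans ?_
      exact refineSample_law hY hZ hlaw hfg hp a
    · refine (hmap (hpair p q
        {w | F j w.1 = F j w.2 ∧ F (j + 1) w.1 ≠ F (j + 1) w.2})).trans_le ?_
      have hp' := refineSample_ae hY hlaw hfg hp
      have hq' := refineSample_ae hY hlaw hfg hq
      rcases Nat.lt_succ_iff_lt_or_eq.1 hj with hj | rfl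
      · have h1 : (stdSpace.prod stdSpace).real
            ({u | F j (Z p u) = F j (Z q u) ∧ F (j + 1) (Z p u) ≠ F (j + 1) (Z q u)} ×ˢ
              Set.univ) ≤ K * (pushDist (F j) p q + pushDist (F (j + 1)) p q) := by
          rw [measureReal_prod_prod, probReal_univ, mul_one]
          exact hmis p hp q hq j hj
        refine le_trans (le_of_eq (measureReal_congr ?_)) h1
        filter_upwards [hp', hq'] with z hzp hzq
        have h2 (k) (hk : k ≤ i) (p) (hz : F i (W p z) = Z p z.1) :
            F k (Z p z.1) = F k (W p z) := by rw [← hz, hF _ _ _ hk]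
        refine propext ?_
        show (F j (W p z) = F j (W q z) ∧ F (j + 1) (W p z) ≠ F (j + 1) (W q z)) ↔
          ((F j (Z p z.1) = F j (Z q z.1) ∧ F (j + 1) (Z p z.1) ≠ F (j + 1) (Z q z.1)) ∧ True)
        rw [h2 j hj.le p hzp, h2 j hj.le q hzq, h2 (j + 1) hj p hzp, h2 (j + 1) hj q hzq, and_true]
      · refine le_trans (ENNReal.toReal_mono (measure_ne_top _ _) (measure_mono_ae ?_))
          (refineSample_mismatch hK hY hlaw hfg hp hq)
        filter_upwards [hp', hq'] with z hzp hzq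
        rintro ⟨h1, h2⟩
        refine ⟨?_, fun h => h2 (congrArg (F (j + 1)) h)⟩
        rw [← hzp, ← hzq]
        exact h1

end refinement

/-- Points are equivalent at level `i` if all their labels up to level `i` agree. -/
def labelSetoid {X : Type*} (l : ℕ → X → ℕ) (i : ℕ) : Setoid X where
  r x y := ∀ j ≤ i, l j x = l j y
  iseqv := ⟨fun _ _ _ => rfl, fun h j hj => (h j hj).symm, fun h h' j hj =>
    (h j hj).trans (h' j hj)⟩

/-- A chosen representative of the level `i` class of a point. -/
def labelRep {X : Type*} (l : ℕ → X → ℕ) (i : ℕ) (x : X) : X :=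
  (Quotient.mk (labelSetoid l i) x).out

section labelRep
variable {X : Type*} (l : ℕ → X → ℕ)

lemma labelRep_eq_iff (i : ℕ) (x y : X) :
    labelRep l i x = labelRep l i y ↔ ∀ j ≤ i, l j x = l j y := by
  rw [labelRep, labelRep, Quotient.out_inj, Quotient.eq]
  rfl

lemma label_labelRep {i j : ℕ} (hj : j ≤ i) (x : X) : l j (labelRep l i x) = l j x :=
  Quotient.exact (s := labelSetoid l i) (Quotient.out_eq _) j hj

lemma labelRep_labelRep {i j : ℕ} (hj : j ≤ i) (x : X) :
    labelRep l j (labelRep l i x) = labelRep l j x :=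
  (labelRep_eq_iff l _ _ _).2 fun _ hk => label_labelRep l (hk.trans hj) x

end labelRep

lemma dist_le_sum_first_separation {X : Type*} [MetricSpace X] [DecidableEq X]
    {F : ℕ → X → X} {L : ℕ} {D : ℕ → ℝ} (hD : ∀ i, 0 ≤ D i) (x y : X) (h0 : F 0 x = F 0 y)
    (hL : F L x = F L y → x = y) (hd : ∀ i < L, F i x = F i y → dist x y ≤ D i) :
    dist x y ≤ ∑ i ∈ Finset.range L,
      if F i x = F i y ∧ F (i + 1) x ≠ F (i + 1) y then D i else 0 := by
  have hnn : ∀ i ∈ Finset.range L,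
      0 ≤ if F i x = F i y ∧ F (i + 1) x ≠ F (i + 1) y then D i else 0 := fun i _ => by
    split_ifs
    exacts [hD i, le_rfl]
  by_cases hxy : x = y
  · rw [hxy, dist_self]
    simp
  have hex : ∃ k, F k x ≠ F k y := ⟨L, mt hL hxy⟩
  have hk := Nat.find_spec hex
  have hkL : Nat.find hex ≤ L := Nat.find_min' hex (mt hL hxy)
  obtain ⟨m, hm⟩ : ∃ m, Nat.find hex = m + 1 := Nat.exists_eq_succ_of_ne_zero fun h => by
    rw [h] at hk
    exact hk h0
  have hm' : F m x = F m y := not_not.1 (Nat.find_min hex (by omega))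
  rw [hm] at hk
  have hmL : m < L := by omega
  calc dist x y ≤ D m := hd m hmL hm'
    _ = if F m x = F m y ∧ F (m + 1) x ≠ F (m + 1) y then D m else 0 :=
        (if_pos ⟨hm', hk⟩).symm
    _ ≤ _ := Finset.single_le_sum hnn (Finset.mem_range.2 hmL)

section
variable {X : Type*} [Fintype X] [DecidableEq X]

lemma pushDist_le (f : X → X) {p q : X → ℝ} {γ : X → X → ℝ} (hγ : ∀ x y, 0 ≤ γ x y)
    (hγp : ∀ x, ∑ y, γ x y = p x) (hγq : ∀ y, ∑ x, γ x y = q y) :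
    pushDist f p q ≤ ∑ x, ∑ y, γ x y * (2 * if f x = f y then 0 else 1) := by
  have h1 (a : X) : pushMass f p a - pushMass f q a
      = ∑ x, ∑ y, γ x y * ((if f x = a then 1 else 0) - if f y = a then 1 else 0) := by
    have hp : pushMass f p a = ∑ x, ∑ y, γ x y * (if f x = a then 1 else 0) := by
      rw [pushMass, Finset.sum_filter]
      refine Finset.sum_congr rfl fun x _ => ?_
      rw [← Finset.sum_mul, hγp]
      simp
    have hq : pushMass f q a = ∑ x, ∑ y, γ x y * (if f y = a then 1 else 0) := by
      rw [pushMass, Finset.sum_filter, Finset.sum_comm]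
      refine Finset.sum_congr rfl fun x _ => ?_
      rw [← Finset.sum_mul, hγq]
      simp
    simp only [hp, hq, mul_sub, Finset.sum_sub_distrib]
  have h2 (x y : X) : ∑ a, |((if f x = a then 1 else 0) - if f y = a then 1 else 0 : ℝ)|
      ≤ 2 * if f x = f y then 0 else 1 := by
    by_cases h : f x = f y
    · simp [h]
    · refine (Finset.sum_le_sum fun a _ => abs_sub _ _).trans ?_
      rw [Finset.sum_add_distrib, if_neg h]
      simp only [apply_ite abs, abs_one, abs_zero, Finset.sum_ite_eq, Finset.mem_univ, if_true]
      norm_num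
  calc pushDist f p q ≤ ∑ a, ∑ x, ∑ y,
        γ x y * |((if f x = a then 1 else 0) - if f y = a then 1 else 0 : ℝ)| := by
        refine Finset.sum_le_sum fun a _ => ?_
        rw [h1]
        refine (Finset.abs_sum_le_sum_abs _ _).trans (Finset.sum_le_sum fun x _ =>
          (Finset.abs_sum_le_sum_abs _ _).trans (Finset.sum_le_sum fun y _ => ?_))
        rw [abs_mul, abs_of_nonneg (hγ x y)]
    _ = ∑ x, ∑ y, γ x y * ∑ a, |((if f x = a then 1 else 0) - if f y = a then 1 else 0 : ℝ)| := by
        rw [Finset.sum_comm]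
        refine Finset.sum_congr rfl fun x _ => ?_
        rw [Finset.sum_comm]
        simp only [Finset.mul_sum]
    _ ≤ _ := Finset.sum_le_sum fun x _ => Finset.sum_le_sum fun y _ =>
        mul_le_mul_of_nonneg_left (h2 x y) (hγ x y)

lemma sum_scales_le (r : ℝ) (hr : 0 ≤ r) (s σ : ℕ → ℝ) (hs : ∀ j, 0 ≤ s j)
    (hσ : ∀ i, σ i ≤ ∑ j ∈ Finset.range (i + 1), s j) (L : ℕ) :
    ∑ i ∈ Finset.range L, 2 * (r / 2 ^ i) * (2 * σ i + 2 * σ (i + 1))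
      ≤ 24 * ∑ j ∈ Finset.range (L + 1), r / 2 ^ j * s j := by
  have key : ∀ L : ℕ, ∑ i ∈ Finset.range L, 2 * (r / 2 ^ i) * (2 * σ i + 2 * σ (i + 1))
      + 16 * (r / 2 ^ L) * ∑ j ∈ Finset.range (L + 1), s j
      ≤ 24 * ∑ j ∈ Finset.range (L + 1), r / 2 ^ j * s j := by
    intro L
    induction L with
    | zero => simp; nlinarith [mul_nonneg hr (hs 0)]
    | succ L ih =>
      rw [Finset.sum_range_succ _ L, Finset.sum_range_succ _ (L + 1),
        Finset.sum_range_succ _ (L + 1)]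
      have h1 := hσ L
      have h2 := hσ (L + 1)
      rw [Finset.sum_range_succ _ (L + 1)] at h2
      set S := ∑ j ∈ Finset.range (L + 1), s j
      have ht : 0 ≤ r / 2 ^ L := by positivity
      have ht' : r / 2 ^ (L + 1) = r / 2 ^ L / 2 := by rw [pow_succ, div_div]
      rw [ht']
      set t := r / 2 ^ L
      have h3 := mul_le_mul_of_nonneg_left h1 ht
      have h4 := mul_le_mul_of_nonneg_left h2 ht
      nlinarith
  have hS : 0 ≤ 16 * (r / 2 ^ L) * ∑ j ∈ Finset.range (L + 1), s j :=
    mul_nonneg (by positivity) (Finset.sum_nonneg fun j _ => hs j)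
  linarith [key L]

end

/-- The coupling attached to a sequence of labellings of a finite metric space by sets of
geometrically decreasing diameters: its cost is controlled by the separation of labels. -/
lemma exists_label_coupling {X : Type*} [MetricSpace X] [Fintype X] [Nonempty X]
    [MeasurableSpace X] [DiscreteMeasurableSpace X] {Y : (X → ℝ) → ℝ → X} {K : ℝ} (hK : 0 ≤ K)
    (hY : IsSampler stdSpace Y K) (L : ℕ) (l : ℕ → X → ℕ) :
    ∃ Z : (X → ℝ) → ℝ → X, (∀ p, Measurable (Z p)) ∧
      ((∀ x y, l 0 x = l 0 y) → (∀ x y, l L x = l L y → x = y) →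
        (∀ p ∈ stdSimplex ℝ X, ∀ x, stdSpace.real {u | Z p u = x} = p x) ∧
        ∀ r : ℝ, 0 ≤ r → (∀ j x y, j ≤ L → l j x = l j y → dist x y ≤ 2 * (r / 2 ^ j)) →
          ∀ p ∈ stdSimplex ℝ X, ∀ q ∈ stdSimplex ℝ X, ∀ γ : X → X → ℝ, (∀ x y, 0 ≤ γ x y) →
            (∀ x, ∑ y, γ x y = p x) → (∀ y, ∑ x, γ x y = q y) →
            ∫⁻ u, ENNReal.ofReal (dist (Z p u) (Z q u)) ∂stdSpace ≤ ENNReal.ofReal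
              (K * ∑ x, ∑ y, γ x y * (24 * ∑ j ∈ Finset.range (L + 1),
                r / 2 ^ j * if l j x = l j y then 0 else 1))) := by
  classical
  by_cases h0 : ∀ x y, l 0 x = l 0 y
  swap
  · exact ⟨fun _ _ => Classical.arbitrary X, fun _ => measurable_const, fun h => absurd h h0⟩
  by_cases hL : ∀ x y, l L x = l L y → x = y
  swap
  · exact ⟨fun _ _ => Classical.arbitrary X, fun _ => measurable_const, fun _ h => absurd h hL⟩
  let F := labelRep l
  have hF0 (x) : F 0 x = F 0 (Classical.arbitrary X) :=
    (labelRep_eq_iff l _ _ _).2 fun j hj => by rw [Nat.le_zero.1 hj]; exact h0 _ _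
  have hFL (x y) (h : F L x = F L y) : x = y := hL x y ((labelRep_eq_iff l _ _ _).1 h L le_rfl)
  have hFLid (x) : F L x = x := hFL _ _ (labelRep_labelRep l le_rfl x)
  obtain ⟨Z, hZ, hlaw, hmis⟩ := exists_chain_sampler hK hY F
    (fun i j x hj => labelRep_labelRep l hj x) _ hF0 L
  refine ⟨Z, hZ, fun _ _ => ⟨fun p hp x => ?_, ?_⟩⟩
  · rw [hlaw p hp, pushMass]
    simp [hFLid, Finset.sum_filter]
  intro r hr hdiam p hp q hq γ hγ hγp hγq
  let D (i : ℕ) : ℝ := 2 * (r / 2 ^ i)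
  have hD (i) : 0 ≤ D i := by positivity
  let S (i : ℕ) : Set ℝ :=
    {u | F i (Z p u) = F i (Z q u) ∧ F (i + 1) (Z p u) ≠ F (i + 1) (Z q u)}
  have hS (i) : MeasurableSet (S i) := ((hZ p).prodMk (hZ q)) (MeasurableSet.of_discrete
    (s := {w : X × X | F i w.1 = F i w.2 ∧ F (i + 1) w.1 ≠ F (i + 1) w.2}))
  have hint (i) : Integrable ((S i).indicator fun _ => D i) stdSpace :=
    (integrable_const _).indicator (hS i)
  calc ∫⁻ u, ENNReal.ofReal (dist (Z p u) (Z q u)) ∂stdSpace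
      ≤ ∫⁻ u, ENNReal.ofReal (∑ i ∈ Finset.range L, (S i).indicator (fun _ => D i) u) ∂stdSpace := by
        refine lintegral_mono fun u => ENNReal.ofReal_le_ofReal ?_
        refine (dist_le_sum_first_separation (F := F) hD (Z p u) (Z q u)
          ((hF0 _).trans (hF0 _).symm) (hFL _ _) fun i hi h => hdiam i _ _ hi.le
            ((labelRep_eq_iff l _ _ _).1 h i le_rfl)).trans_eq ?_
        refine Finset.sum_congr rfl fun i _ => ?_
        simp only [Set.indicator, S, Set.mem_ofPred_eq]
    _ = ENNReal.ofReal (∑ i ∈ Finset.range L, stdSpace.real (S i) * D i) := by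
        rw [← ofReal_integral_eq_lintegral_ofReal (integrable_finsetSum _ fun i _ => hint i)
          (Filter.Eventually.of_forall fun u => Finset.sum_nonneg fun i _ =>
            Set.indicator_nonneg (fun _ _ => hD i) u),
          integral_finsetSum _ fun i _ => hint i]
        simp only [integral_indicator_const _ (hS _), smul_eq_mul]
    _ ≤ _ := by
        refine ENNReal.ofReal_le_ofReal ?_
        let σ (x y : X) (i : ℕ) : ℝ := if F i x = F i y then 0 else 1
        calc _ ≤ ∑ i ∈ Finset.range L, K * (∑ x, ∑ y, γ x y * (2 * σ x y i)
                + ∑ x, ∑ y, γ x y * (2 * σ x y (i + 1))) * D i := by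
              refine Finset.sum_le_sum fun i hi => mul_le_mul_of_nonneg_right ?_ (hD i)
              exact (hmis p hp q hq i (Finset.mem_range.1 hi)).trans
                (mul_le_mul_of_nonneg_left (add_le_add (pushDist_le _ hγ hγp hγq)
                  (pushDist_le _ hγ hγp hγq)) hK)
          _ = K * ∑ x, ∑ y, γ x y * ∑ i ∈ Finset.range L,
                2 * (r / 2 ^ i) * (2 * σ x y i + 2 * σ x y (i + 1)) := by
              simp only [Finset.mul_sum, Finset.sum_mul, ← Finset.sum_add_distrib]
              rw [Finset.sum_comm]
              refine Finset.sum_congr rfl fun x _ => ?_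
              rw [Finset.sum_comm]
              refine Finset.sum_congr rfl fun y _ => Finset.sum_congr rfl fun i _ => ?_
              simp only [D]
              ring
          _ ≤ _ := by
              refine mul_le_mul_of_nonneg_left (Finset.sum_le_sum fun x _ =>
                Finset.sum_le_sum fun y _ => mul_le_mul_of_nonneg_left ?_ (hγ x y)) hK
              refine sum_scales_le r hr _ (σ x y) (fun j => by split_ifs <;> norm_num) ?_ L
              intro i
              have hnn : ∀ j ∈ Finset.range (i + 1),
                  (0 : ℝ) ≤ if l j x = l j y then 0 else 1 := fun j _ => by
                split_ifs <;> norm_num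
              by_cases h : F i x = F i y
              · simpa [σ, h] using Finset.sum_nonneg hnn
              · have h' := mt (labelRep_eq_iff l i x y).2 h
                push Not at h'
                obtain ⟨j, hj, hne⟩ := h'
                simp only [σ, if_neg h]
                refine le_trans ?_ (Finset.single_le_sum hnn (Finset.mem_range_succ_iff.2 hj))
                rw [if_neg hne]

/-- The smallest priority of a member of the set `B`. -/
def minPriority {X : Type*} {n : ℕ} (π : X ≃ Fin n) (B : X → Prop) : ℕ :=
  sInf {k | ∃ w, B w ∧ (π w : ℕ) = k}

lemma exists_minPriority_eq {X : Type*} {n : ℕ} (π : X ≃ Fin n) {B : X → Prop} {x : X}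
    (hx : B x) : ∃ w, B w ∧ (π w : ℕ) = minPriority π B :=
  Nat.sInf_mem (s := {k | ∃ w, B w ∧ (π w : ℕ) = k}) ⟨_, x, hx, rfl⟩

lemma minPriority_le {X : Type*} {n : ℕ} (π : X ≃ Fin n) {B : X → Prop} {x : X} (hx : B x) :
    minPriority π B ≤ π x :=
  Nat.sInf_le ⟨x, hx, rfl⟩

section ball
variable {X : Type*} [MetricSpace X] {n : ℕ} (π : X ≃ Fin n)

/-- The priority of the first centre within distance `r` of `x`. -/
def ballLabel (r : ℝ) (x : X) : ℕ := minPriority π fun w => dist w x ≤ r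

variable {π}

lemma exists_common_center {r : ℝ} (hr : 0 ≤ r) {x y : X}
    (h : ballLabel π r x = ballLabel π r y) : ∃ w, dist w x ≤ r ∧ dist w y ≤ r := by
  obtain ⟨w, hw, hw'⟩ := exists_minPriority_eq π (B := fun w => dist w x ≤ r) (x := x)
    (by simpa using hr)
  obtain ⟨v, hv, hv'⟩ := exists_minPriority_eq π (B := fun w => dist w y ≤ r) (x := y)
    (by simpa using hr)
  have : w = v := π.injective (Fin.ext (hw'.trans (h.trans hv'.symm)))
  exact ⟨w, hw, this ▸ hv⟩

lemma dist_le_of_ballLabel_eq {r : ℝ} (hr : 0 ≤ r) {x y : X}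
    (h : ballLabel π r x = ballLabel π r y) : dist x y ≤ 2 * r := by
  obtain ⟨w, hw, hw'⟩ := exists_common_center hr h
  linarith [dist_triangle_left x y w]

lemma eq_of_ballLabel_eq {r : ℝ} (hr : 0 ≤ r) (hsep : ∀ x y : X, dist x y ≤ r → x = y) {x y : X}
    (h : ballLabel π r x = ballLabel π r y) : x = y := by
  obtain ⟨w, hw, hw'⟩ := exists_common_center hr h
  exact (hsep _ _ hw).symm.trans (hsep _ _ hw')

lemma ballLabel_eq_of_dist_le {r : ℝ} (hr : ∀ x y : X, dist x y ≤ r) (x y : X) :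
    ballLabel π r x = ballLabel π r y := by
  simp [ballLabel, hr]

lemma exists_cutting_center [Finite X] {r : ℝ} (hr : 0 ≤ r) {x y : X}
    (h : ballLabel π r x ≠ ballLabel π r y) :
    ∃ w, (min (dist w x) (dist w y) ≤ r ∧ r < max (dist w x) (dist w y)) ∧
      ∀ v, min (dist v x) (dist v y) ≤ r → π w ≤ π v := by
  obtain ⟨w, hw, hmin⟩ := Set.exists_min_image {v | min (dist v x) (dist v y) ≤ r} π
    (Set.toFinite _) ⟨x, by simpa using Or.inl hr⟩
  refine ⟨w, ⟨hw, ?_⟩, hmin⟩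
  by_contra hmax
  rw [not_lt, max_le_iff] at hmax
  have key (z : X) (hz : dist w z ≤ r)
      (hzr : ∀ v, dist v z ≤ r → min (dist v x) (dist v y) ≤ r) : ballLabel π r z = π w := by
    refine le_antisymm (minPriority_le π hz) ?_
    obtain ⟨v, hv, hv'⟩ := exists_minPriority_eq π (B := fun w => dist w z ≤ r) hz
    rw [ballLabel, ← hv']
    exact hmin v (hzr v hv)
  exact h ((key x hmax.1 fun v hv => (min_le_left _ _).trans hv).trans
    (key y hmax.2 fun v hv => (min_le_right _ _).trans hv).symm)

end ball

/-- In a uniformly random order a given element of `S` comes first with probability at most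
`1 / |S|`. -/
lemma card_first_mul_card_le {X : Type*} [Fintype X] [DecidableEq X] {n : ℕ} (S : Finset X)
    {w : X} (hw : w ∈ S) :
    (Finset.univ.filter fun π : X ≃ Fin n => ∀ v ∈ S, π w ≤ π v).card * S.card
      ≤ Fintype.card (X ≃ Fin n) := by
  let A (z : X) : Finset (X ≃ Fin n) := Finset.univ.filter fun π => ∀ v ∈ S, π z ≤ π v
  have hcard : ∀ z ∈ S, (A w).card ≤ (A z).card := by
    intro z hz
    refine Finset.card_le_card_of_injOn (fun π => (Equiv.swap w z).trans π) ?_ ?_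
    · intro π hπ
      simp only [A, Finset.coe_filter, Finset.mem_univ, true_and, Set.mem_ofPred_eq,
        Equiv.trans_apply, Equiv.swap_apply_right] at hπ ⊢
      intro v hv
      apply hπ
      rcases eq_or_ne v w with rfl | hvw
      · simpa using hz
      rcases eq_or_ne v z with rfl | hvz
      · simpa using hw
      · rwa [Equiv.swap_apply_of_ne_of_ne hvw hvz]
    · intro π _ π' _ h
      ext x
      have := DFunLike.congr_fun h (Equiv.swap w z x)
      simpa using congrArg Fin.val this
  have hdisj : (S : Set X).PairwiseDisjoint A := by
    intro z hz z' hz' hne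
    rw [Function.onFun, Finset.disjoint_left]
    intro π h h'
    simp only [A, Finset.mem_filter, Finset.mem_univ, true_and] at h h'
    exact hne (π.injective (le_antisymm (h z' hz') (h' z hz)))
  calc (A w).card * S.card = ∑ _z ∈ S, (A w).card := by rw [Finset.sum_const, smul_eq_mul, mul_comm]
    _ ≤ ∑ z ∈ S, (A z).card := Finset.sum_le_sum hcard
    _ = (S.biUnion A).card := (Finset.card_biUnion hdisj).symm
    _ ≤ _ := Finset.card_le_univ _

/-- The number of points that `a` ranks no higher than `w`. -/
def rankCard {X : Type*} [Fintype X] (a : X → ℝ) (w : X) : ℕ :=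
  (Finset.univ.filter fun v => a v ≤ a w).card

lemma rankCard_pos {X : Type*} [Fintype X] (a : X → ℝ) (w : X) : 0 < rankCard a w :=
  Finset.card_pos.2 ⟨w, by simp⟩

lemma sum_one_div_rankCard_le {X : Type*} [Fintype X] (a : X → ℝ) :
    ∑ w, 1 / (rankCard a w : ℝ) ≤ 1 + Real.log (Fintype.card X) := by
  classical
  have key (s : Finset X) :
      ∑ w ∈ s, 1 / ((s.filter fun v => a v ≤ a w).card : ℝ) ≤ (harmonic s.card : ℝ) := by
    induction s using Finset.induction_on_max_value a with
    | empty => simp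
    | insert z s hz hmax ih =>
      rw [Finset.sum_insert hz, Finset.card_insert_of_notMem hz, harmonic_succ, add_comm]
      push_cast
      refine add_le_add (le_trans (Finset.sum_le_sum fun w hw => ?_) ih) ?_
      · refine one_div_le_one_div_of_le ?_ ?_
        · exact_mod_cast Finset.card_pos.2 ⟨w, by simp [hw]⟩
        · exact_mod_cast Finset.card_le_card
            (Finset.filter_subset_filter _ (Finset.subset_insert z s))
      · rw [Finset.filter_true_of_mem, Finset.card_insert_of_notMem hz]
        · simp
        · intro v hv
          rcases Finset.mem_insert.1 hv with rfl | hv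
          exacts [le_rfl, hmax v hv]
  exact (key Finset.univ).trans (harmonic_le_one_add_log _)

/-- The probability, over a uniformly random order of the centres, that two points are assigned
to different centres. -/
lemma sum_separated_le {X : Type*} [MetricSpace X] [Fintype X] {n : ℕ}
    [Nonempty (X ≃ Fin n)] {r : ℝ} (hr : 0 ≤ r) (x y : X) [Fintype (X ≃ Fin n)] :
    1 / (Fintype.card (X ≃ Fin n) : ℝ) *
        ∑ π : X ≃ Fin n, (if ballLabel π r x = ballLabel π r y then 0 else 1)
      ≤ ∑ w, 1 / (rankCard (fun v => min (dist v x) (dist v y)) w : ℝ) *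
        if min (dist w x) (dist w y) ≤ r ∧ r < max (dist w x) (dist w y) then 1 else 0 := by
  classical
  set a : X → ℝ := fun v => min (dist v x) (dist v y) with ha
  let S (w : X) : Finset X := Finset.univ.filter fun v => a v ≤ a w
  let c (w : X) : ℝ := if a w ≤ r ∧ r < max (dist w x) (dist w y) then 1 else 0
  have hc (w) : 0 ≤ c w := by simp only [c]; split_ifs <;> norm_num
  have hN : (0 : ℝ) < Fintype.card (X ≃ Fin n) := by exact_mod_cast Fintype.card_pos
  have h1 (π : X ≃ Fin n) : (if ballLabel π r x = ballLabel π r y then (0 : ℝ) else 1)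
      ≤ ∑ w, c w * if ∀ v ∈ S w, π w ≤ π v then 1 else 0 := by
    have hnn : ∀ w ∈ Finset.univ, 0 ≤ c w * if ∀ v ∈ S w, π w ≤ π v then (1 : ℝ) else 0 :=
      fun w _ => mul_nonneg (hc w) (by split_ifs <;> norm_num)
    split_ifs with h
    · exact Finset.sum_nonneg hnn
    · obtain ⟨w, hw, hmin⟩ := exists_cutting_center hr h
      refine le_trans ?_ (Finset.single_le_sum hnn (Finset.mem_univ w))
      have h2 : ∀ v ∈ S w, π w ≤ π v := fun v hv =>
        hmin v ((Finset.mem_filter.1 hv).2.trans hw.1)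
      rw [if_pos h2]
      simp only [c]
      rw [if_pos hw, mul_one]
  calc _ ≤ 1 / (Fintype.card (X ≃ Fin n) : ℝ) *
        ∑ π : X ≃ Fin n, ∑ w, c w * if ∀ v ∈ S w, π w ≤ π v then 1 else 0 := by
        gcongr with π
        exact h1 π
    _ = ∑ w, (1 / (Fintype.card (X ≃ Fin n) : ℝ) *
          (Finset.univ.filter fun π : X ≃ Fin n => ∀ v ∈ S w, π w ≤ π v).card) * c w := by
        rw [Finset.sum_comm, Finset.mul_sum]
        refine Finset.sum_congr rfl fun w _ => ?_
        rw [← Finset.mul_sum, Finset.sum_boole]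
        ring
    _ ≤ _ := by
        refine Finset.sum_le_sum fun w _ => mul_le_mul_of_nonneg_right ?_ (hc w)
        have hpos : (0 : ℝ) < rankCard a w := by exact_mod_cast rankCard_pos a w
        rw [one_div_mul_eq_div, div_le_div_iff₀ hN hpos, one_mul]
        have := card_first_mul_card_le (n := n) (S w) (w := w) (by simp [S])
        exact_mod_cast (by convert this : (Finset.univ.filter fun π : X ≃ Fin n =>
          ∀ v ∈ S w, π w ≤ π v).card * (S w).card ≤ Fintype.card (X ≃ Fin n))

/-- The expected total radius of the scales at which a sphere of random radius falls between
`a` and `b`. -/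
lemma integral_radii_le {T a b : ℝ} (hT : 0 < T) (hab : a ≤ b) (L : ℕ) :
    Integrable (fun β : ℝ => ∑ j ∈ Finset.range (L + 1), β * T / 2 ^ j *
        if a ≤ β * T / 2 ^ j ∧ β * T / 2 ^ j < b then 1 else 0)
      (volume.restrict (Set.Ico 1 2)) ∧
    ∫ β in Set.Ico (1 : ℝ) 2, ∑ j ∈ Finset.range (L + 1), β * T / 2 ^ j *
        (if a ≤ β * T / 2 ^ j ∧ β * T / 2 ^ j < b then 1 else 0) ≤ 2 * (b - a) := by
  let t (j : ℕ) : ℝ := T / 2 ^ j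
  have ht (j) : 0 < t j := by positivity
  have hfun (j : ℕ) : (fun β : ℝ => β * T / 2 ^ j *
      if a ≤ β * T / 2 ^ j ∧ β * T / 2 ^ j < b then 1 else 0)
      = (Set.Ico (a / t j) (b / t j)).indicator fun β => β * t j := by
    ext β
    simp only [Set.indicator, Set.mem_Ico, div_le_iff₀ (ht j), lt_div_iff₀ (ht j), t, mul_div_assoc,
      mul_ite, mul_one, mul_zero]
  have hi (j : ℕ) : Integrable (fun β : ℝ => β * T / 2 ^ j *
      if a ≤ β * T / 2 ^ j ∧ β * T / 2 ^ j < b then 1 else 0)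
      (volume.restrict (Set.Ico 1 2)) := by
    rw [hfun]
    refine Integrable.indicator ?_ measurableSet_Ico
    exact ((by fun_prop : Continuous fun β : ℝ => β * t j).integrableOn_Icc
      (a := 1) (b := 2)).mono_set Set.Ico_subset_Icc_self
  refine ⟨integrable_finsetSum _ fun j _ => hi j, ?_⟩
  let φ (s : ℝ) : ℝ := max a (min b s)
  have hterm (j : ℕ) : ∫ β in Set.Ico (1 : ℝ) 2, (β * T / 2 ^ j *
      if a ≤ β * T / 2 ^ j ∧ β * T / 2 ^ j < b then 1 else 0) ≤ 2 * (φ (2 * t j) - φ (t j)) := by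
    have h1 : ∫ β in Set.Ico (1 : ℝ) 2, (β * T / 2 ^ j *
        if a ≤ β * T / 2 ^ j ∧ β * T / 2 ^ j < b then 1 else 0)
        ≤ ∫ β in Set.Ico (1 : ℝ) 2, (Set.Ico (a / t j) (b / t j)).indicator (fun _ => 2 * t j) β := by
      refine setIntegral_mono_on (hi j) ((integrable_const _).indicator measurableSet_Ico)
        measurableSet_Ico fun β hβ => ?_
      have := congrFun (hfun j) β
      rw [this]
      exact Set.indicator_le_indicator (mul_le_mul_of_nonneg_right hβ.2.le (ht j).le)
    refine h1.trans ?_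
    rw [integral_indicator_const _ measurableSet_Ico, measureReal_restrict_apply measurableSet_Ico,
      Set.Ico_inter_Ico, Real.volume_real_Ico, smul_eq_mul, max_mul_of_nonneg _ _ (by linarith [ht j])]
    have h2 : φ (t j) ≤ φ (2 * t j) :=
      max_le_max le_rfl (min_le_min le_rfl (by linarith [ht j]))
    refine max_le ?_ (by simpa using h2)
    have h3 : min (b / t j) 2 * t j = min b (2 * t j) := by
      rw [min_mul_of_nonneg _ _ (ht j).le, div_mul_cancel₀ _ (ht j).ne']
    have h4 : max (a / t j) 1 * t j = max a (t j) := by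
      rw [max_mul_of_nonneg _ _ (ht j).le, div_mul_cancel₀ _ (ht j).ne', one_mul]
    have h5 : min b (2 * t j) ≤ φ (2 * t j) := le_max_right _ _
    have h6 : φ (t j) ≤ max a (t j) := max_le_max le_rfl (min_le_right _ _)
    calc _ = 2 * (min (b / t j) 2 * t j - max (a / t j) 1 * t j) := by ring
      _ ≤ _ := by rw [h3, h4]; linarith
  rw [integral_finsetSum _ fun j _ => hi j]
  refine (Finset.sum_le_sum fun j _ => hterm j).trans ?_
  have htel : ∑ j ∈ Finset.range (L + 1), (φ (2 * T / 2 ^ j) - φ (2 * T / 2 ^ (j + 1)))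
      = φ (2 * T / 2 ^ 0) - φ (2 * T / 2 ^ (L + 1)) :=
    Finset.sum_range_sub' (fun j => φ (2 * T / 2 ^ j)) (L + 1)
  have hconv (j : ℕ) : φ (2 * t j) - φ (t j) = φ (2 * T / 2 ^ j) - φ (2 * T / 2 ^ (j + 1)) := by
    congr 2
    · simp only [t]; ring
    · simp only [t]; rw [pow_succ]; field_simp
  rw [← Finset.mul_sum, Finset.sum_congr rfl fun j _ => hconv j, htel]
  have h7 : φ (2 * T / 2 ^ 0) ≤ b := max_le hab (min_le_left _ _)
  have h8 : a ≤ φ (2 * T / 2 ^ (L + 1)) := le_max_left _ _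
  linarith

lemma exists_separation (X : Type*) [MetricSpace X] [Finite X] [Nontrivial X] :
    ∃ δ : ℝ, 0 < δ ∧ ∀ x y : X, dist x y < δ → x = y := by
  obtain ⟨a, b, hab⟩ := exists_pair_ne X
  have : Nonempty {z : X × X // z.1 ≠ z.2} := ⟨⟨(a, b), hab⟩⟩
  obtain ⟨z, hz⟩ := Finite.exists_min fun z : {z : X × X // z.1 ≠ z.2} => dist z.1.1 z.1.2
  refine ⟨dist z.1.1 z.1.2, dist_pos.2 z.2, fun x y h => ?_⟩
  by_contra hxy
  exact (hz ⟨(x, y), hxy⟩).not_gt h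

lemma exists_dist_bound (X : Type*) [MetricSpace X] [Finite X] :
    ∃ T : ℝ, 0 < T ∧ ∀ x y : X, dist x y ≤ T := by
  obtain ⟨C, hC⟩ := (Set.finite_range fun z : X × X => dist z.1 z.2).bddAbove
  exact ⟨max C 1, by positivity, fun x y => le_max_of_le_left (hC ⟨(x, y), rfl⟩)⟩

instance equivFinMeasurableSpace {X : Type*} {n : ℕ} : MeasurableSpace (X ≃ Fin n) := ⊤

instance {X : Type*} {n : ℕ} : DiscreteMeasurableSpace (X ≃ Fin n) := ⟨fun _ => trivial⟩

lemma measurable_ballLabel {X : Type*} [MetricSpace X] [Finite X] {n : ℕ} (π : X ≃ Fin n) (x : X) :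
    Measurable fun r : ℝ => ballLabel π r x := by
  have h : Measurable fun (r : ℝ) (w : X) => dist w x ≤ r :=
    measurable_pi_lambda _ fun w => measurableSet_setOfPred.1 measurableSet_Ici
  exact (Measurable.of_discrete (f := minPriority π)).comp h

/-- A uniform random radius scale, a uniform random permutation and an independent uniform seed. -/
def seedMeasure (X : Type*) [Fintype X] : Measure (ℝ × (X ≃ Fin (Fintype.card X)) × ℝ) :=
  (volume.restrict (Set.Ico 1 2)).prod ((ProbabilityTheory.uniformOn Set.univ).prod stdSpace)

instance : IsProbabilityMeasure (volume.restrict (Set.Ico (1 : ℝ) 2)) :=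
  ⟨by rw [Measure.restrict_apply_univ, Real.volume_Ico]; norm_num⟩

instance {X : Type*} [Fintype X] : Nonempty (X ≃ Fin (Fintype.card X)) := ⟨Fintype.equivFin X⟩

instance {X : Type*} [Fintype X] : IsProbabilityMeasure (seedMeasure X) := by
  unfold seedMeasure
  have := ProbabilityTheory.isProbabilityMeasure_uniformOn
    (s := (Set.univ : Set (X ≃ Fin (Fintype.card X)))) Set.finite_univ Set.univ_nonempty
  infer_instance

lemma lintegral_seedMeasure {X : Type*} [Fintype X] [Fintype (X ≃ Fin (Fintype.card X))]
    {f : ℝ × (X ≃ Fin (Fintype.card X)) × ℝ → ℝ≥0∞} (hf : Measurable f) :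
    ∫⁻ ω, f ω ∂seedMeasure X = ∫⁻ β in Set.Ico 1 2,
      ∑ π, ENNReal.ofReal (1 / Fintype.card (X ≃ Fin (Fintype.card X))) *
        ∫⁻ u, f (β, π, u) ∂stdSpace := by
  rw [seedMeasure, lintegral_prod _ hf.aemeasurable]
  refine lintegral_congr fun β => ?_
  rw [lintegral_prod _ (by fun_prop), lintegral_fintype]
  refine Finset.sum_congr rfl fun π _ => ?_
  rw [uniformOn_univ_singleton, mul_comm]

lemma setLIntegral_ofReal_separated_le {X : Type*} [MetricSpace X] [Fintype X] [Nonempty X]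
    [Fintype (X ≃ Fin (Fintype.card X))] {T K : ℝ} (hT : 0 < T) (hK : 0 ≤ K) (L : ℕ)
    {γ : X → X → ℝ} (hγ : ∀ x y, 0 ≤ γ x y) :
    ∫⁻ β in Set.Ico (1 : ℝ) 2, ∑ π : X ≃ Fin (Fintype.card X),
      ENNReal.ofReal (1 / Fintype.card (X ≃ Fin (Fintype.card X))) * ENNReal.ofReal
        (K * ∑ x, ∑ y, γ x y * (24 * ∑ j ∈ Finset.range (L + 1), β * T / 2 ^ j *
          if ballLabel π (β * T / 2 ^ j) x = ballLabel π (β * T / 2 ^ j) y then 0 else 1))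
      ≤ ENNReal.ofReal (K * 48 * (1 + Real.log (Fintype.card X)) *
          ∑ x, ∑ y, γ x y * dist x y) := by
  let N : ℝ := Fintype.card (X ≃ Fin (Fintype.card X))
  let I (x y w : X) (β : ℝ) : ℝ := ∑ j ∈ Finset.range (L + 1), β * T / 2 ^ j *
    if min (dist w x) (dist w y) ≤ β * T / 2 ^ j ∧ β * T / 2 ^ j < max (dist w x) (dist w y)
      then 1 else 0
  let c (x y w : X) : ℝ := 1 / (rankCard (fun v => min (dist v x) (dist v y)) w : ℝ)
  have hc (x y w : X) : 0 ≤ c x y w := by positivity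
  let G (β : ℝ) : ℝ := K * ∑ x, ∑ y, γ x y * (24 * ∑ w, c x y w * I x y w β)
  have hI (x y w : X) := integral_radii_le hT (min_le_max (a := dist w x) (b := dist w y)) L
  have hint (x y : X) : Integrable (fun β => γ x y * (24 * ∑ w, c x y w * I x y w β))
      (volume.restrict (Set.Ico 1 2)) :=
    ((integrable_finsetSum _ fun w _ => (hI x y w).1.const_mul _).const_mul _).const_mul _
  have hGint : Integrable G (volume.restrict (Set.Ico 1 2)) :=
    (integrable_finsetSum _ fun x _ => integrable_finsetSum _ fun y _ => hint x y).const_mul _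
  have hG0 (β : ℝ) (hβ : β ∈ Set.Ico (1 : ℝ) 2) : 0 ≤ G β := by
    have h1 : 0 ≤ β := by linarith [hβ.1]
    refine mul_nonneg hK (Finset.sum_nonneg fun x _ => Finset.sum_nonneg fun y _ =>
      mul_nonneg (hγ x y) (mul_nonneg (by norm_num) (Finset.sum_nonneg fun w _ =>
        mul_nonneg (hc x y w) (Finset.sum_nonneg fun j _ => ?_))))
    split_ifs <;> positivity
  have hpt (β : ℝ) (hβ : β ∈ Set.Ico (1 : ℝ) 2) : ∑ π : X ≃ Fin (Fintype.card X),
      ENNReal.ofReal (1 / N) * ENNReal.ofReal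
        (K * ∑ x, ∑ y, γ x y * (24 * ∑ j ∈ Finset.range (L + 1), β * T / 2 ^ j *
          if ballLabel π (β * T / 2 ^ j) x = ballLabel π (β * T / 2 ^ j) y then 0 else 1))
      ≤ ENNReal.ofReal (G β) := by
    have h1 : 0 ≤ β := by linarith [hβ.1]
    have hN : 0 ≤ 1 / N := by positivity
    rw [← Finset.mul_sum, ← ENNReal.ofReal_sum_of_nonneg, ← ENNReal.ofReal_mul hN]
    swap
    · refine fun π _ => mul_nonneg hK (Finset.sum_nonneg fun x _ => Finset.sum_nonneg fun y _ =>
        mul_nonneg (hγ x y) (mul_nonneg (by norm_num) (Finset.sum_nonneg fun j _ => ?_)))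
      split_ifs <;> positivity
    refine ENNReal.ofReal_le_ofReal ?_
    have hswap : 1 / N * ∑ π : X ≃ Fin (Fintype.card X),
        (K * ∑ x, ∑ y, γ x y * (24 * ∑ j ∈ Finset.range (L + 1), β * T / 2 ^ j *
          if ballLabel π (β * T / 2 ^ j) x = ballLabel π (β * T / 2 ^ j) y then 0 else 1))
        = K * ∑ x, ∑ y, γ x y * (24 * ∑ j ∈ Finset.range (L + 1), β * T / 2 ^ j *
          (1 / N * ∑ π : X ≃ Fin (Fintype.card X),
          if ballLabel π (β * T / 2 ^ j) x = ballLabel π (β * T / 2 ^ j) y then 0 else 1)) := by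
      rw [← Finset.mul_sum, Finset.sum_comm, mul_left_comm, Finset.mul_sum]
      congr 1
      refine Finset.sum_congr rfl fun x _ => ?_
      rw [Finset.sum_comm, Finset.mul_sum]
      refine Finset.sum_congr rfl fun y _ => ?_
      rw [← Finset.mul_sum, ← Finset.mul_sum, Finset.sum_comm, mul_left_comm,
        mul_left_comm (1 / N), Finset.mul_sum]
      congr 2
      refine Finset.sum_congr rfl fun j _ => ?_
      rw [← Finset.mul_sum, mul_left_comm]
    rw [hswap]
    refine mul_le_mul_of_nonneg_left (Finset.sum_le_sum fun x _ => Finset.sum_le_sum fun y _ =>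
      mul_le_mul_of_nonneg_left (mul_le_mul_of_nonneg_left ?_ (by norm_num)) (hγ x y)) hK
    calc _ ≤ ∑ j ∈ Finset.range (L + 1), β * T / 2 ^ j * ∑ w, c x y w *
          if min (dist w x) (dist w y) ≤ β * T / 2 ^ j ∧
            β * T / 2 ^ j < max (dist w x) (dist w y) then 1 else 0 :=
          Finset.sum_le_sum fun j _ => mul_le_mul_of_nonneg_left
            (sum_separated_le (by positivity) x y) (by positivity)
      _ = ∑ w, c x y w * I x y w β := by
          simp only [I, Finset.mul_sum]
          rw [Finset.sum_comm]
          exact Finset.sum_congr rfl fun w _ => Finset.sum_congr rfl fun j _ => by ring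
  have hGle : ∫ β in Set.Ico (1 : ℝ) 2, G β ≤ K * 48 * (1 + Real.log (Fintype.card X)) *
      ∑ x, ∑ y, γ x y * dist x y := by
    simp only [G]
    rw [integral_const_mul, integral_finsetSum _ fun x _ => integrable_finsetSum _ fun y _ =>
      hint x y, mul_assoc, mul_assoc]
    refine mul_le_mul_of_nonneg_left ?_ hK
    simp only [Finset.mul_sum]
    refine Finset.sum_le_sum fun x _ => ?_
    simp only [← Finset.mul_sum]
    rw [integral_finsetSum _ fun y _ => hint x y]
    simp only [Finset.mul_sum]
    refine Finset.sum_le_sum fun y _ => ?_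
    simp only [← Finset.mul_sum]
    rw [integral_const_mul, integral_const_mul,
      integral_finsetSum _ fun w _ => (hI x y w).1.const_mul _]
    have hd (w : X) : max (dist w x) (dist w y) - min (dist w x) (dist w y) ≤ dist x y := by
      rw [max_sub_min_eq_abs]
      simpa [dist_comm w] using abs_dist_sub_le y x w |>.trans_eq (dist_comm y x)
    have h1 : ∑ w, ∫ β in Set.Ico (1 : ℝ) 2, c x y w * I x y w β
        ≤ (1 + Real.log (Fintype.card X)) * (2 * dist x y) := by
      refine (Finset.sum_le_sum fun w _ => ?_).trans
        ((Finset.sum_mul _ (c x y) _).symm.trans_le (mul_le_mul_of_nonneg_right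
          (sum_one_div_rankCard_le _) (by positivity)))
      rw [integral_const_mul]
      exact mul_le_mul_of_nonneg_left ((hI x y w).2.trans (by linarith [hd w])) (hc x y w)
    calc _ ≤ γ x y * (24 * ((1 + Real.log (Fintype.card X)) * (2 * dist x y))) :=
          mul_le_mul_of_nonneg_left (mul_le_mul_of_nonneg_left h1 (by norm_num)) (hγ x y)
      _ = _ := by ring
  calc _ ≤ ∫⁻ β in Set.Ico (1 : ℝ) 2, ENNReal.ofReal (G β) :=
        setLIntegral_mono' measurableSet_Ico hpt
    _ = ENNReal.ofReal (∫ β in Set.Ico (1 : ℝ) 2, G β) :=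
        (ofReal_integral_eq_lintegral_ofReal hGint
          (ae_restrict_of_forall_mem measurableSet_Ico hG0)).symm
    _ ≤ _ := ENNReal.ofReal_le_ofReal hGle

lemma exists_seed_coupling {X : Type*} [MetricSpace X] [Fintype X] [Nontrivial X]
    [MeasurableSpace X] [DiscreteMeasurableSpace X] {Y : (X → ℝ) → ℝ → X} {K : ℝ} (hK : 0 ≤ K)
    (hY : IsSampler stdSpace Y K) :
    ∃ Z : (X → ℝ) → ℝ × (X ≃ Fin (Fintype.card X)) × ℝ → X, (∀ p, Measurable (Z p)) ∧
      (∀ p ∈ stdSimplex ℝ X, ∀ x, seedMeasure X {ω | Z p ω = x} = ENNReal.ofReal (p x)) ∧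
      ∀ p ∈ stdSimplex ℝ X, ∀ q ∈ stdSimplex ℝ X, ∀ γ : X → X → ℝ, (∀ x y, 0 ≤ γ x y) →
        (∀ x, ∑ y, γ x y = p x) → (∀ y, ∑ x, γ x y = q y) →
        ∫⁻ ω, ENNReal.ofReal (dist (Z p ω) (Z q ω)) ∂seedMeasure X ≤
          ENNReal.ofReal (K * 48 * (1 + Real.log (Fintype.card X)) *
            ∑ x, ∑ y, γ x y * dist x y) := by
  classical
  obtain ⟨δ, hδ, hsep⟩ := exists_separation X
  obtain ⟨T, hT, hdiam⟩ := exists_dist_bound X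
  obtain ⟨L, hL⟩ : ∃ L : ℕ, 2 * T / δ < 2 ^ L := pow_unbounded_of_one_lt _ one_lt_two
  have hL' : 2 * T / 2 ^ L < δ := by
    rw [div_lt_iff₀ (by positivity)]
    rw [div_lt_iff₀ hδ] at hL
    linarith
  let unfin (P : Fin (L + 1) → X → ℕ) (j : ℕ) : X → ℕ := P (Fin.ofNat (L + 1) j)
  choose W hW hW' using fun P => exists_label_coupling hK hY L (unfin P)
  let pat (β : ℝ) (π : X ≃ Fin (Fintype.card X)) (j : Fin (L + 1)) (x : X) : ℕ :=
    ballLabel π (β * T / 2 ^ (j : ℕ)) x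
  have hext (β : ℝ) (π) {j : ℕ} (hj : j ≤ L) (x) :
      unfin (pat β π) j x = ballLabel π (β * T / 2 ^ j) x := by
    simp [unfin, pat, Fin.ofNat, Nat.mod_eq_of_lt (Nat.lt_succ_of_le hj)]
  have hpat (π : X ≃ Fin (Fintype.card X)) : Measurable fun β => pat β π :=
    measurable_pi_lambda _ fun j => measurable_pi_lambda _ fun x =>
      (measurable_ballLabel π x).comp (by fun_prop)
  let Z (p : X → ℝ) (ω : ℝ × (X ≃ Fin (Fintype.card X)) × ℝ) : X := W (pat ω.1 ω.2.1) p ω.2.2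
  have hpatM : Measurable fun z : ℝ × (X ≃ Fin (Fintype.card X)) => pat z.1 z.2 :=
    measurable_from_prod_countable_left hpat
  have hWM (p : X → ℝ) : Measurable fun z : (Fin (L + 1) → X → ℕ) × ℝ => W z.1 p z.2 :=
    measurable_from_prod_countable_right fun P => hW P p
  have hZ (p) : Measurable (Z p) :=
    (hWM p).comp ((hpatM.comp (by fun_prop :
      Measurable fun ω : ℝ × (X ≃ Fin (Fintype.card X)) × ℝ => (ω.1, ω.2.1))).prodMk
        (by fun_prop))
  have hgood (β : ℝ) (hβ : β ∈ Set.Ico (1 : ℝ) 2) (π) :=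
    hW' (pat β π) (fun x y => by
      rw [hext β π (Nat.zero_le L), hext β π (Nat.zero_le L)]
      refine ballLabel_eq_of_dist_le (fun v w => (hdiam v w).trans ?_) x y
      rw [pow_zero, div_one]
      nlinarith [hβ.1]) (fun x y h => by
      rw [hext β π le_rfl, hext β π le_rfl] at h
      refine eq_of_ballLabel_eq (by have := hβ.1; positivity)
        (fun v w hvw => hsep v w (hvw.trans_lt (lt_of_le_of_lt ?_ hL'))) h
      gcongr
      exact hβ.2.le)
  refine ⟨Z, hZ, fun p hp x => ?_, fun p hp q hq γ hγ h1 h2 => ?_⟩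
  · have hms : MeasurableSet {ω | Z p ω = x} := hZ p (MeasurableSet.of_discrete (s := {x}))
    rw [← lintegral_indicator_one hms, lintegral_seedMeasure (measurable_one.indicator hms)]
    refine (setLIntegral_congr_fun measurableSet_Ico (g := fun _ => ENNReal.ofReal (p x))
      fun β hβ => ?_).trans (by simp)
    have hin (π) : ∫⁻ u, {ω | Z p ω = x}.indicator 1 (β, π, u) ∂stdSpace
        = ENNReal.ofReal (p x) := by
      have hms' : MeasurableSet {u | W (pat β π) p u = x} :=
        hW _ p (MeasurableSet.of_discrete (s := {x}))
      rw [← (hgood β hβ π).1 p hp x, ofReal_measureReal, ← lintegral_indicator_one hms']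
      rfl
    simp only [hin, Finset.sum_const, Finset.card_univ, nsmul_eq_mul]
    rw [← ENNReal.ofReal_natCast, ← mul_assoc, ← ENNReal.ofReal_mul (by positivity),
      mul_one_div_cancel (by exact_mod_cast Fintype.card_ne_zero), ENNReal.ofReal_one, one_mul]
  · rw [lintegral_seedMeasure (by
      exact ((Measurable.of_discrete (f := fun z : X × X => dist z.1 z.2)).comp
        ((hZ p).prodMk (hZ q))).ennreal_ofReal)]
    refine le_trans (setLIntegral_mono' measurableSet_Ico fun β hβ => Finset.sum_le_sum fun π _ =>
      mul_le_mul_right ?_ _) (setLIntegral_ofReal_separated_le hT hK L hγ)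
    have hβ0 : 0 ≤ β := by linarith [hβ.1]
    refine ((hgood β hβ π).2 (β * T) (by positivity) (fun j x y hj h => ?_) p hp q hq γ hγ h1
      h2).trans_eq ?_
    · rw [hext β π hj, hext β π hj] at h
      exact dist_le_of_ballLabel_eq (by positivity) h
    · congr 2
      refine Finset.sum_congr rfl fun x _ => Finset.sum_congr rfl fun y _ => ?_
      congr 2
      refine Finset.sum_congr rfl fun j hj => ?_
      have hj' : j ≤ L := Nat.lt_succ_iff.1 (Finset.mem_range.1 hj)
      rw [hext β π hj', hext β π hj']

lemma real_singleton_mem_stdSimplex {X : Type*} [Fintype X] [MeasurableSpace X]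
    [MeasurableSingletonClass X] (P : Measure X) [IsProbabilityMeasure P] :
    (fun x => P.real {x}) ∈ stdSimplex ℝ X :=
  ⟨fun _ => measureReal_nonneg, by
    rw [sum_measureReal_singleton, Finset.coe_univ, probReal_univ]⟩

lemma optRatio_le_of_sampler {X : Type*} [MetricSpace X] [Fintype X] [Nontrivial X]
    [MeasurableSpace X] [DiscreteMeasurableSpace X] {Y : (X → ℝ) → ℝ → X} {K : ℝ} (hK : 1 ≤ K)
    (hY : IsSampler stdSpace Y K) :
    optRatio (fun x y : X => dist x y) (fun P : ProbabilityMeasure X => (P : Measure X))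
      ≤ ENNReal.ofReal (K * 48 * (1 + Real.log (Fintype.card X))) := by
  obtain ⟨Z, hZ, hlaw, hcost⟩ := exists_seed_coupling (by linarith) hY
  obtain ⟨φ, hφ, hφ'⟩ := exists_measurable_map_stdSpace_eq (seedMeasure X)
  let p (P : ProbabilityMeasure X) (x : X) : ℝ := (P : Measure X).real {x}
  have hp (P) : p P ∈ stdSimplex ℝ X := real_singleton_mem_stdSimplex _
  let f (P : ProbabilityMeasure X) (u : ℝ) : X := Z (p P) (φ u)
  have hlog : 0 ≤ Real.log (Fintype.card X) := Real.log_natCast_nonneg _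
  have hf : IsCoupling (fun P : ProbabilityMeasure X => (P : Measure X)) f := by
    refine ⟨fun P => (hZ _).comp hφ, fun P => Measure.ext_of_singleton fun x => ?_⟩
    rw [show f P = Z (p P) ∘ φ from rfl, ← Measure.map_map (hZ _) hφ, hφ',
      Measure.map_apply (hZ _) (MeasurableSet.singleton x)]
    exact (hlaw _ (hp P) x).trans ofReal_measureReal
  refine iInf₂_le_of_le f hf (sInf_le ⟨?_, fun P Q => ?_⟩)
  · rw [ENNReal.one_le_ofReal]
    nlinarith
  set C := K * 48 * (1 + Real.log (Fintype.card X)) with hC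
  have hC0 : 0 < C := by positivity
  have hne : ENNReal.ofReal C ≠ 0 := (ENNReal.ofReal_pos.2 hC0).ne'
  rw [mul_comm, ← ENNReal.div_le_iff hne ENNReal.ofReal_ne_top]
  refine le_iInf₂ fun γ hγ => ?_
  obtain ⟨hγp, hγ1, hγ2⟩ := hγ
  dsimp only at hγ1 hγ2
  rw [ENNReal.div_le_iff hne ENNReal.ofReal_ne_top]
  have hmap : ∫⁻ u, ENNReal.ofReal (dist (f P u) (f Q u)) ∂stdSpace
      = ∫⁻ ω, ENNReal.ofReal (dist (Z (p P) ω) (Z (p Q) ω)) ∂seedMeasure X := by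
    rw [← hφ', lintegral_map _ hφ]
    exact ((Measurable.of_discrete (f := fun z : X × X => dist z.1 z.2)).comp
      ((hZ _).prodMk (hZ _))).ennreal_ofReal
  rw [hmap]
  refine (hcost _ (hp P) _ (hp Q) (fun x y => γ.real {(x, y)}) (fun _ _ => measureReal_nonneg)
    (fun x => ?_) (fun y => ?_)).trans_eq ?_
  · simp only [p]
    rw [← hγ1, map_measureReal_apply measurable_fst (MeasurableSet.singleton x)]
    have h : (Prod.fst ⁻¹' {x} : Set (X × X)) = ⋃ y : X, {(x, y)} := by
      ext ⟨a, b⟩; simp [eq_comm]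
    rw [h, measureReal_iUnion_fintype (fun a b hab => by simpa using hab)
      fun _ => MeasurableSet.singleton _]
  · simp only [p]
    rw [← hγ2, map_measureReal_apply measurable_snd (MeasurableSet.singleton y)]
    have h : (Prod.snd ⁻¹' {y} : Set (X × X)) = ⋃ x : X, {(x, y)} := by
      ext ⟨a, b⟩; simp [eq_comm]
    rw [h, measureReal_iUnion_fintype (fun a b hab => by simpa using hab)
      fun _ => MeasurableSet.singleton _]
  · rw [ENNReal.ofReal_mul hC0.le, mul_comm, lintegral_fintype, ← Fintype.sum_prod_type',
      ENNReal.ofReal_sum_of_nonneg fun z _ => by positivity]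
    congr 1
    refine Finset.sum_congr rfl fun z _ => ?_
    rw [ENNReal.ofReal_mul measureReal_nonneg, ofReal_measureReal, mul_comm]

/-- for a finite metric space `X` with at least two points and the
cost `c = d`, the optimal pairwise coupling ratio of the family of all Borel
probability measures on `X` satisfies `r*_c(P(X)) < 55.7 (1 + log |X|)`. -/
theorem finite_metric_optRatio_lt {X : Type*} [MetricSpace X] [Fintype X] [Nontrivial X]
    [MeasurableSpace X] [BorelSpace X] :
    optRatio (fun x y : X => dist x y)
        (fun P : ProbabilityMeasure X => (P : Measure X))
      < ENNReal.ofReal (55.7 * (1 + Real.log (Fintype.card X))) := by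
  obtain ⟨Y, hY⟩ := exists_isSampler X (C := 1.16) (by norm_num)
  have hlog : 0 ≤ Real.log (Fintype.card X) := Real.log_natCast_nonneg _
  refine (optRatio_le_of_sampler (by norm_num) hY).trans_lt ?_
  rw [ENNReal.ofReal_lt_ofReal_iff (by positivity)]
  nlinarith

end
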